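/- arXiv:math/0601317 — 2 statements merged into one kernel-verified Lean document; each statement's English description precedes it below -/
import Mathlib

section
/- Let a be a nonnegative element of the descent algebra Σ(W) of a finite Coxeter system (W,S). Then a is invertible in Σ(W) if and only if ξ_S(a) > 0. -/
open MonoidAlgebra

variable {B W : Type*} [DecidableEq B] [Fintype B] [Group W] [Fintype W] [DecidableEq W]

/-- `x_I`: the sum, in the group algebra `ℚW`, of the minimal length coset
representatives of the standard parabolic subgroup `W_I` in `W`, i.e. the sum of the
`w ∈ W` such that `ws > w` for all `s ∈ I`. -/
noncomputable def descentBasis {M : CoxeterMatrix B} (cs : CoxeterSystem M W)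
    (I : Finset B) : MonoidAlgebra ℚ W :=
  ∑ w : W, if ∀ i ∈ I, cs.length w < cs.length (w * cs.simple i)
    then MonoidAlgebra.single w (1 : ℚ) else 0

/-- `A` is the Solomon descent algebra `Σ(W)` of `(W,S)`: a subalgebra of the group
algebra `ℚW` whose underlying set is the span of the elements `x_I`, `I ⊆ S`.
(By Solomon's theorem this span is indeed closed under multiplication.) -/
def IsDescentAlgebra {M : CoxeterMatrix B} (cs : CoxeterSystem M W)
    (A : Subalgebra ℚ (MonoidAlgebra ℚ W)) : Prop :=
  (A : Set (MonoidAlgebra ℚ W)) = Submodule.span ℚ (Set.range (descentBasis cs))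


set_option linter.unusedSectionVars false

namespace DescentAux

/-- The linear form `v ↦ 2 B(α_i, v)` of the geometric representation. -/
noncomputable def geomForm (M : CoxeterMatrix B) (i : B) : Module.Dual ℝ (B → ℝ) :=
  ∑ j : B, (-2 * Real.cos (Real.pi / (M i j : ℝ))) • LinearMap.proj j

theorem geomForm_single (M : CoxeterMatrix B) (i j : B) :
    geomForm M i (Pi.single j 1) = -2 * Real.cos (Real.pi / (M i j : ℝ)) := by
  simp [geomForm, LinearMap.sum_apply, Pi.single_apply]

theorem geomForm_self (M : CoxeterMatrix B) (i : B) :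
    geomForm M i (Pi.single i 1) = 2 := by
  rw [geomForm_single, M.diagonal]
  simp

/-- The generating reflections of the geometric representation. -/
noncomputable def geomRefl (M : CoxeterMatrix B) (i : B) : (B → ℝ) ≃ₗ[ℝ] (B → ℝ) :=
  Module.reflection (geomForm_self M i)

theorem geomRefl_liftable (M : CoxeterMatrix B) : M.IsLiftable (geomRefl M) := by
  intro i j
  by_cases hij : i = j
  · subst hij
    rw [M.diagonal, pow_one]
    ext1 v
    exact Module.involutive_reflection (geomForm_self M i) v
  set m := M i j with hm
  have hm1 : m ≠ 1 := M.off_diagonal i j hij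
  have hmj : M j i = m := M.symmetric j i
  rcases Nat.lt_or_ge m 2 with h2 | h2
  · have : m = 0 := by omega
    rw [this, pow_zero]
  have hgij : geomForm M i (Pi.single j 1) = -2 * Real.cos (Real.pi / (m : ℝ)) :=
    geomForm_single M i j
  have hgji : geomForm M j (Pi.single i 1) = -2 * Real.cos (Real.pi / (m : ℝ)) := by
    rw [geomForm_single, hmj]
  rcases Nat.eq_or_lt_of_le h2 with h2 | h3
  · have hc : Real.cos (Real.pi / (m : ℝ)) = 0 := by
      rw [← h2]; norm_num
    rw [hc, mul_zero] at hgij hgji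
    rw [← h2]
    ext1 v
    simp only [geomRefl, pow_two, LinearEquiv.mul_apply, Module.reflection_apply, map_sub, map_smul,
      hgij, hgji, geomForm_self, LinearEquiv.coe_one, id]
    module
  set θ : ℝ := 2 * Real.pi / m with hθ
  have hmpos : (0 : ℝ) < m := by positivity
  have hsin : Real.sin θ ≠ 0 := by
    apply ne_of_gt
    apply Real.sin_pos_of_pos_of_lt_pi
    · positivity
    · rw [hθ, div_lt_iff₀ hmpos]
      have : (3 : ℝ) ≤ m := by exact_mod_cast h3
      nlinarith [Real.pi_pos]
  have ht : 2 * Real.cos θ = geomForm M i (Pi.single j 1) * geomForm M j (Pi.single i 1) - 2 := by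
    rw [hgij, hgji, hθ, mul_div_assoc, Real.cos_two_mul]
    ring
  have hS (n : ℤ) := Polynomial.Chebyshev.S_two_mul_real_cos θ n
  have hmθ : (m : ℝ) * θ = 2 * Real.pi := by
    rw [hθ]; field_simp
  ext1 v
  have key := Module.reflection_mul_reflection_pow_apply (geomForm_self M i) (geomForm_self M j)
    m v (2 * Real.cos θ) ht
  change ((Module.reflection (geomForm_self M i) * Module.reflection (geomForm_self M j)) ^ m) v = v
  rw [key]
  obtain ⟨k, hk | hk⟩ := Nat.even_or_odd' m
  · have e1 : ((m : ℤ) - 2) / 2 = (k : ℤ) - 1 := by omega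
    have e2 : ((m : ℤ) - 1) / 2 = (k : ℤ) - 1 := by omega
    have z : (Polynomial.Chebyshev.S ℝ ((k : ℤ) - 1)).eval (2 * Real.cos θ) = 0 := by
      have h := hS ((k : ℤ) - 1)
      have : (((k : ℤ) - 1 : ℤ) + 1 : ℝ) * θ = Real.pi := by
        rw [hk] at hmθ
        push_cast at hmθ ⊢
        linarith
      rw [this, Real.sin_pi] at h
      exact (mul_eq_zero.mp h).resolve_right hsin
    rw [e1, e2, z]
    simp
  · have e1 : ((m : ℤ) - 1) / 2 = (k : ℤ) := by omega
    have e2 : ((m : ℤ) - 3) / 2 = (k : ℤ) - 1 := by omega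
    have e3 : (m : ℤ) / 2 = (k : ℤ) := by omega
    have e4 : ((m : ℤ) - 2) / 2 = (k : ℤ) - 1 := by omega
    have z : (Polynomial.Chebyshev.S ℝ (k : ℤ)).eval (2 * Real.cos θ) +
        (Polynomial.Chebyshev.S ℝ ((k : ℤ) - 1)).eval (2 * Real.cos θ) = 0 := by
      have h := hS (k : ℤ)
      have h' := hS ((k : ℤ) - 1)
      have a1 : (((k : ℤ) - 1 : ℤ) + 1 : ℝ) * θ = k * θ := by push_cast; ring
      have a2 : (((k : ℤ) : ℝ) + 1) * θ = 2 * Real.pi - k * θ := by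
        rw [hk] at hmθ
        push_cast at hmθ ⊢
        linarith
      rw [a2, Real.sin_two_pi_sub] at h
      rw [a1] at h'
      refine (mul_eq_zero.mp ?_).resolve_right hsin
      rw [add_mul, h, h']
      ring
    rw [e1, e2, e3, e4, z]
    simp

/-- The standard parabolic subgroup. -/
def par {M : CoxeterMatrix B} (cs : CoxeterSystem M W) (J : Finset B) : Subgroup W :=
  Subgroup.closure (cs.simple '' (J : Set B))

theorem simple_mem_par {M : CoxeterMatrix B} (cs : CoxeterSystem M W) {J : Finset B} {j : B}
    (hj : j ∈ J) : cs.simple j ∈ par cs J :=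
  Subgroup.subset_closure ⟨j, hj, rfl⟩

theorem mem_of_simple_mem_par {M : CoxeterMatrix B} (cs : CoxeterSystem M W) {J : Finset B} {i : B}
    (hi : cs.simple i ∈ par cs J) : i ∈ J := by
  by_contra hiJ
  let ρ := cs.lift ⟨geomRefl M, geomRefl_liftable M⟩
  have hρ (k : B) : ρ (cs.simple k) = geomRefl M k := cs.lift_apply_simple _ _
  have key : ∀ u ∈ par cs J, ∀ v : B → ℝ, (ρ u v) i = v i := by
    intro u hu
    induction hu using Subgroup.closure_induction with
    | mem x hx =>
      obtain ⟨j, hj, rfl⟩ := hx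
      intro v
      have hne : i ≠ j := by rintro rfl; exact hiJ hj
      rw [hρ, geomRefl, Module.reflection_apply]
      simp [hne]
    | one => intro v; simp
    | mul x y _ _ hx hy =>
      intro v
      rw [map_mul, LinearEquiv.mul_apply, hx, hy]
    | inv x _ hx =>
      intro v
      rw [← hx (ρ x⁻¹ v), ← LinearEquiv.mul_apply, ← map_mul]
      simp
  have h := key _ hi (Pi.single i 1)
  rw [hρ, geomRefl, Module.reflection_apply_self] at h
  simp at h
  norm_num at h

variable {M : CoxeterMatrix B} (cs : CoxeterSystem M W)

/-- The map `(t, ε) ↦ (s t s, ε + [t = s])`. -/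
def sgnFun (i : B) (p : W × ZMod 2) : W × ZMod 2 :=
  (cs.simple i * p.1 * cs.simple i, p.2 + if p.1 = cs.simple i then 1 else 0)

theorem sgnFun_sgnFun (i : B) (p : W × ZMod 2) : sgnFun cs i (sgnFun cs i p) = p := by
  obtain ⟨t, e⟩ := p
  have h : cs.simple i * t * cs.simple i = cs.simple i ↔ t = cs.simple i := by
    constructor
    · intro h
      have := congrArg (fun x => cs.simple i * x * cs.simple i) h
      simpa [mul_assoc] using this
    · rintro rfl; simp
  simp only [sgnFun, h, Prod.mk.injEq]
  constructor
  · simp [mul_assoc]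
  · rw [add_assoc, CharTwo.add_self_eq_zero, add_zero]

/-- `sgnFun` as a permutation. -/
def sgnPerm (i : B) : Equiv.Perm (W × ZMod 2) :=
  ⟨sgnFun cs i, sgnFun cs i, sgnFun_sgnFun cs i, sgnFun_sgnFun cs i⟩

theorem sgnPerm_pow (i j : B) (k : ℕ) (t : W) (e : ZMod 2) :
    ((sgnPerm cs i * sgnPerm cs j) ^ k) (t, e) =
      ((cs.simple i * cs.simple j) ^ k * t * (cs.simple j * cs.simple i) ^ k,
        e + ∑ l ∈ Finset.range (2 * k),
          if t = (cs.simple j * cs.simple i) ^ l * cs.simple j then 1 else 0) := by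
  induction k with
  | zero => simp
  | succ k ih =>
    set a := cs.simple i with ha
    set b := cs.simple j with hb
    have haa : a * a = 1 := cs.simple_mul_simple_self i
    have hbb : b * b = 1 := cs.simple_mul_simple_self j
    have hinv : (a * b)⁻¹ = b * a := by
      rw [mul_inv_rev, ha, hb, cs.inv_simple, cs.inv_simple]
    have hinv' : (b * a)⁻¹ = a * b := by rw [← hinv, inv_inv]
    have hpow : ((a * b) ^ k) = ((b * a) ^ k)⁻¹ := by rw [← inv_pow, hinv']
    have hcomm : ∀ k : ℕ, b * (a * b) ^ k = (b * a) ^ k * b := by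
      intro k
      induction k with
      | zero => simp
      | succ k ih => rw [pow_succ, ← mul_assoc, ih, pow_succ]; simp [mul_assoc]
    have h1 : (a * b) ^ k * t * (b * a) ^ k = b ↔ t = (b * a) ^ (2 * k) * b := by
      rw [hpow, mul_assoc, inv_mul_eq_iff_eq_mul, ← eq_mul_inv_iff_mul_eq, ← hpow, mul_assoc, hcomm,
        ← mul_assoc, ← pow_add, two_mul]
    have h2 : b * ((a * b) ^ k * t * (b * a) ^ k) * b = a ↔ t = (b * a) ^ (2 * k + 1) * b := by
      have : b * ((a * b) ^ k * t * (b * a) ^ k) * b = a ↔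
          (a * b) ^ k * t * (b * a) ^ k = b * a * b := by
        generalize (a * b) ^ k * t * (b * a) ^ k = x
        constructor
        · intro h
          rw [← h]
          simp only [mul_assoc, hbb, mul_one]
          simp only [← mul_assoc, hbb, one_mul]
        · intro h
          rw [h]
          simp only [mul_assoc, hbb, mul_one]
          simp only [← mul_assoc, hbb, one_mul]
      rw [this, hpow, mul_assoc, inv_mul_eq_iff_eq_mul, ← eq_mul_inv_iff_mul_eq, ← hpow]
      have : (b * a) ^ k * (b * a * b) * (a * b) ^ k = (b * a) ^ (2 * k + 1) * b := by
        rw [mul_assoc, mul_assoc (b * a), hcomm, ← mul_assoc, ← mul_assoc, ← pow_succ, ← pow_add]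
        congr 2
        ring
      rw [this]
    rw [pow_succ', Equiv.Perm.mul_apply, ih]
    have hstep : ∀ p : W × ZMod 2, (sgnPerm cs i * sgnPerm cs j) p =
      sgnFun cs i (sgnFun cs j p) := fun p => rfl
    rw [hstep]
    simp only [sgnFun, ← ha, ← hb, h1, h2]
    have hr : 2 * (k + 1) = 2 * k + 1 + 1 := by ring
    rw [hr, Finset.sum_range_succ, Finset.sum_range_succ, pow_succ' (a * b), pow_succ (b * a) k]
    simp only [mul_assoc, add_assoc]

theorem sgnPerm_liftable : M.IsLiftable (sgnPerm cs) := by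
  intro i j
  ext1 ⟨t, e⟩
  rw [sgnPerm_pow]
  have h1 : (cs.simple i * cs.simple j) ^ M i j = 1 := cs.simple_mul_simple_pow i j
  have h2 : (cs.simple j * cs.simple i) ^ M i j = 1 := by
    rw [M.symmetric i j]; exact cs.simple_mul_simple_pow j i
  rw [two_mul, Finset.sum_range_add]
  simp only [pow_add, h1, h2, one_mul, mul_one, CharTwo.add_self_eq_zero, add_zero]
  rfl

/-- The homomorphism `W → Perm (W × ℤ/2)`. -/
noncomputable def sgnHom : W →* Equiv.Perm (W × ZMod 2) :=
  cs.lift ⟨sgnPerm cs, sgnPerm_liftable cs⟩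

theorem sgnHom_simple (i : B) : sgnHom cs (cs.simple i) = sgnPerm cs i :=
  cs.lift_apply_simple _ _

theorem sgnHom_wordProd (ω : List B) (t : W) (e : ZMod 2) :
    sgnHom cs (cs.wordProd ω) (t, e) =
      (cs.wordProd ω * t * (cs.wordProd ω)⁻¹, e + (((cs.rightInvSeq ω).count t : ℕ) : ZMod 2)) := by
  induction ω with
  | nil => simp
  | cons i ω ih =>
    rw [cs.wordProd_cons, map_mul, Equiv.Perm.mul_apply, ih, sgnHom_simple]
    change sgnFun cs i _ = _
    have h : cs.wordProd ω * t * (cs.wordProd ω)⁻¹ = cs.simple i ↔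
        (cs.wordProd ω)⁻¹ * cs.simple i * cs.wordProd ω = t := by
      rw [mul_inv_eq_iff_eq_mul, mul_assoc, inv_mul_eq_iff_eq_mul, eq_comm]
    simp only [sgnFun, h, CoxeterSystem.rightInvSeq, List.count_cons, Prod.mk.injEq]
    constructor
    · simp [mul_assoc]
    · push_cast
      simp [add_assoc]

/-- Side indicator: `1` if `t` is a left inversion of `w`, `0` otherwise. -/
noncomputable def side (w t : W) : ZMod 2 := (sgnHom cs w⁻¹ (t, 0)).2

theorem side_wordProd (ω : List B) (t : W) :
    side cs (cs.wordProd ω) t = (((cs.leftInvSeq ω).count t : ℕ) : ZMod 2) := by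
  rw [side, ← cs.wordProd_reverse, sgnHom_wordProd, cs.rightInvSeq_reverse, List.count_reverse]
  simp

theorem sgnHom_apply (w t : W) (e : ZMod 2) :
    sgnHom cs w (t, e) = (w * t * w⁻¹, e + side cs w⁻¹ t) := by
  obtain ⟨ω, rfl⟩ := cs.wordProd_surjective w
  rw [side, inv_inv, sgnHom_wordProd, sgnHom_wordProd]
  simp

theorem side_mul (a b t : W) : side cs (a * b) t = side cs a t + side cs b (a⁻¹ * t * a) := by
  have : sgnHom cs (a * b)⁻¹ (t, 0) = sgnHom cs b⁻¹ (sgnHom cs a⁻¹ (t, 0)) := by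
    rw [mul_inv_rev, map_mul, Equiv.Perm.mul_apply]
  rw [side, this, sgnHom_apply cs a⁻¹, sgnHom_apply]
  simp

theorem side_one (t : W) : side cs 1 t = 0 := by
  simp [side]

theorem side_simple (i : B) (t : W) :
    side cs (cs.simple i) t = if t = cs.simple i then 1 else 0 := by
  rw [side, cs.inv_simple, sgnHom_simple]
  change (sgnFun cs i _).2 = _
  simp [sgnFun]

theorem side_inv (a t : W) : side cs a⁻¹ t = side cs a (a * t * a⁻¹) := by
  have h := side_mul cs a⁻¹ a t
  rw [inv_mul_cancel, side_one, inv_inv] at h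
  exact CharTwo.add_eq_zero.mp h.symm

theorem side_conj (a t : W) : side cs a (a * t * a⁻¹) = side cs a⁻¹ t :=
  (side_inv cs a t).symm

theorem side_cases (a t : W) : side cs a t = 0 ∨ side cs a t = 1 := by
  generalize side cs a t = x
  revert x
  decide

theorem isLeftInversion_of_side {w t : W} (h : side cs w t ≠ 0) : cs.IsLeftInversion w t := by
  obtain ⟨ω, hω, rfl⟩ := cs.exists_isReduced w
  apply cs.isLeftInversion_of_mem_leftInvSeq hω
  rw [side_wordProd] at h
  by_contra hc
  rw [List.count_eq_zero.mpr hc] at h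
  simp at h

theorem side_refl {t : W} (ht : cs.IsReflection t) : side cs t t = 1 := by
  obtain ⟨w, i, rfl⟩ := ht
  rw [side_mul, side_mul, side_conj, side_simple, side_inv, side_inv]
  have h1 : w⁻¹ * (w * cs.simple i * w⁻¹) * w = cs.simple i := by group
  have h2 : (w * cs.simple i)⁻¹ * (w * cs.simple i * w⁻¹) * (w * cs.simple i) = cs.simple i := by
    group
  rw [h1, h2]
  simp only [if_true]
  rw [add_right_comm, CharTwo.add_self_eq_zero, zero_add]

theorem side_ne_zero_iff {w t : W} (ht : cs.IsReflection t) :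
    side cs w t ≠ 0 ↔ cs.length (t * w) < cs.length w := by
  constructor
  · intro h; exact (isLeftInversion_of_side cs h).2
  · intro h h0
    have h1 : side cs (t * w) t ≠ 0 := by
      rw [side_mul, side_refl cs ht, inv_mul_cancel, one_mul, h0]
      decide
    have h2 := (isLeftInversion_of_side cs h1).2
    rw [← mul_assoc, ht.mul_self, one_mul] at h2
    omega

theorem side_eq_zero_iff {w t : W} (ht : cs.IsReflection t) :
    side cs w t = 0 ↔ cs.length w < cs.length (t * w) := by
  have h := side_ne_zero_iff cs (w := w) ht
  have h2 := ht.length_mul_right_ne w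
  constructor
  · intro h0
    have := mt h.mpr (not_not.mpr h0)
    omega
  · intro h0
    by_contra hc
    have := h.mp hc
    omega

/-- `w` is a minimal length representative of `w W_I`. -/
def InX (I : Finset B) (w : W) : Prop := ∀ i ∈ I, cs.length w < cs.length (w * cs.simple i)

theorem inX_iff (I : Finset B) (w : W) : InX cs I w ↔ ∀ i ∈ I, side cs w⁻¹ (cs.simple i) = 0 := by
  unfold InX
  refine forall₂_congr fun i _ => ?_
  rw [side_eq_zero_iff cs (cs.isReflection_simple i), cs.length_inv, ← cs.length_inv (_ * w⁻¹)]
  simp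

theorem side_par {J : Finset B} {u : W} (hu : u ∈ par cs J) :
    ∀ t, t ∉ par cs J → side cs u t = 0 := by
  induction hu using Subgroup.closure_induction with
  | mem x hx =>
    obtain ⟨j, hj, rfl⟩ := hx
    intro t ht
    rw [side_simple, if_neg]
    rintro rfl
    exact ht (simple_mem_par cs hj)
  | one => intro t _; exact side_one cs t
  | mul x y hx' _ hx hy =>
    intro t ht
    rw [side_mul, hx t ht, hy, add_zero]
    intro h
    apply ht
    have := (par cs J).mul_mem ((par cs J).mul_mem hx' h) ((par cs J).inv_mem hx')
    simpa [mul_assoc] using this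
  | inv x hx' hx =>
    intro t ht
    rw [side_inv, hx]
    intro h
    apply ht
    have := (par cs J).mul_mem ((par cs J).mul_mem ((par cs J).inv_mem hx') h) hx'
    simpa [mul_assoc] using this

theorem exists_simple_side {J : Finset B} {u : W} (hu : u ∈ par cs J) (h1 : u ≠ 1) :
    ∃ j ∈ J, side cs u (cs.simple j) = 1 := by
  obtain ⟨i, hi⟩ := cs.exists_leftDescent_of_ne_one h1
  have hs : side cs u (cs.simple i) ≠ 0 :=
    (side_ne_zero_iff cs (cs.isReflection_simple i)).mpr hi
  refine ⟨i, ?_, (side_cases cs _ _).resolve_left hs⟩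
  apply mem_of_simple_mem_par cs
  by_contra hc
  exact hs (side_par cs hu _ hc)

theorem exists_min (J : Finset B) (v : W) :
    ∃ u ∈ par cs J, ∀ t ∈ par cs J, side cs (u * v) t = 0 := by
  obtain ⟨⟨u, hu⟩, hmin⟩ := 
    Finite.exists_min (fun u : par cs J => cs.length (u.1 * v))
  refine ⟨u, hu, fun t ht => ?_⟩
  by_contra hc
  have h1 := (isLeftInversion_of_side cs hc).2
  have h2 := hmin ⟨t * u, (par cs J).mul_mem ht hu⟩
  simp only [mul_assoc] at h2
  omega

theorem InX.side {J : Finset B} {m : W} (hm : InX cs J m) :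
    ∀ t ∈ par cs J, side cs m⁻¹ t = 0 := by
  rw [inX_iff] at hm
  obtain ⟨u, hu, hmin⟩ := exists_min cs J m⁻¹
  have key : ∀ t ∈ par cs J, DescentAux.side cs m⁻¹ t = DescentAux.side cs u⁻¹ t := by
    intro t ht
    have : m⁻¹ = u⁻¹ * (u * m⁻¹) := by group
    rw [this, side_mul, hmin, add_zero]
    rw [inv_inv]
    exact (par cs J).mul_mem ((par cs J).mul_mem hu ht) ((par cs J).inv_mem hu)
  have hu1 : u⁻¹ = 1 := by
    by_contra hc
    obtain ⟨j, hj, h⟩ := exists_simple_side cs ((par cs J).inv_mem hu) hc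
    rw [← key _ (simple_mem_par cs hj), hm j hj] at h
    exact absurd h (by decide)
  intro t ht
  rw [key t ht, hu1, side_one]

theorem inX_iff' (J : Finset B) (w : W) : InX cs J w ↔ ∀ t ∈ par cs J, side cs w⁻¹ t = 0 :=
  ⟨fun h => h.side, fun h => (inX_iff cs J w).mpr fun _ hi => h _ (simple_mem_par cs hi)⟩

/-- conjugation inside the parabolic subgroup -/
theorem par_conj {J : Finset B} {u t : W} (hu : u ∈ par cs J) (ht : t ∈ par cs J) :
    u * t * u⁻¹ ∈ par cs J :=
  (par cs J).mul_mem ((par cs J).mul_mem hu ht) ((par cs J).inv_mem hu)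

theorem exists_minrep (J : Finset B) (w : W) : ∃ u ∈ par cs J, InX cs J (w * u) := by
  obtain ⟨u, hu, h⟩ := exists_min cs J w⁻¹
  refine ⟨u⁻¹, (par cs J).inv_mem hu, ?_⟩
  rw [inX_iff']
  simpa using h

theorem minrep_unique {J : Finset B} {m u : W} (hu : u ∈ par cs J) (hm : InX cs J m)
    (hmu : InX cs J (m * u)) : u = 1 := by
  by_contra hc
  have hu' := (par cs J).inv_mem hu
  obtain ⟨j, hj, h⟩ := exists_simple_side cs hu' (inv_ne_one.mpr hc)
  have h1 := hmu.side _ _ (simple_mem_par cs hj)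
  rw [mul_inv_rev, side_mul, hm.side, add_zero] at h1
  · rw [h1] at h
    exact absurd h (by decide)
  · rw [inv_inv]
    exact par_conj cs hu (simple_mem_par cs hj)

/-- The minimal representative of `w W_J`. -/
noncomputable def minrep (J : Finset B) (w : W) : W := w * (exists_minrep cs J w).choose

theorem minrep_inX (J : Finset B) (w : W) : InX cs J (minrep cs J w) :=
  (exists_minrep cs J w).choose_spec.2

theorem minrep_mem (J : Finset B) (w : W) : w⁻¹ * minrep cs J w ∈ par cs J := by
  have := (exists_minrep cs J w).choose_spec.1
  simpa [minrep] using this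

theorem eq_minrep {J : Finset B} {w m : W} (hm : InX cs J m) (h : w⁻¹ * m ∈ par cs J) :
    m = minrep cs J w := by
  have h1 : m⁻¹ * minrep cs J w ∈ par cs J := by
    have := (par cs J).mul_mem ((par cs J).inv_mem h) (minrep_mem cs J w)
    simpa [mul_assoc] using this
  have h2 := minrep_unique cs h1 hm (by simpa using minrep_inX cs J w)
  rw [inv_mul_eq_one] at h2
  exact h2

theorem inX_mul_iff {J K : Finset B} (hK : K ⊆ J) {m u : W} (hm : InX cs J m) (hu : u ∈ par cs J) :
    InX cs K (m * u) ↔ InX cs K u := by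
  rw [inX_iff, inX_iff]
  refine forall₂_congr fun i hi => ?_
  rw [mul_inv_rev, side_mul, hm.side, add_zero]
  rw [inv_inv]
  exact par_conj cs hu (simple_mem_par cs (hK hi))

/-- The condition that the projection of `q` to `W_J` is `u`. -/
def Proj (J : Finset B) (q u : W) : Prop := ∀ t ∈ par cs J, side cs q t = side cs u t

theorem inX_inv_mul_iff {J : Finset B} {q u : W} (hu : u ∈ par cs J) :
    InX cs J (q⁻¹ * u) ↔ Proj cs J q u := by
  rw [inX_iff', Proj]
  have key : ∀ t, side cs (q⁻¹ * u)⁻¹ t = 0 ↔ side cs q (u * t * u⁻¹) = side cs u (u * t * u⁻¹) := by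
    intro t
    rw [mul_inv_rev, inv_inv, side_mul, side_inv, inv_inv, CharTwo.add_eq_zero, eq_comm]
  constructor
  · intro h t ht
    have := (key (u⁻¹ * t * u)).mp (h _ (by simpa using par_conj cs ((par cs J).inv_mem hu) ht))
    simpa [mul_assoc] using this
  · intro h t ht
    exact (key t).mpr (h _ (par_conj cs hu ht))

theorem proj_minrep {I J : Finset B} {m p u : W} (hm : InX cs J m) (hp : InX cs I p) :
    Proj cs J (m⁻¹ * p) u ↔ Proj cs J (minrep cs I (m⁻¹ * p)) u := by
  refine forall₂_congr fun t ht => ?_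
  suffices h : side cs (m⁻¹ * p) t = side cs (minrep cs I (m⁻¹ * p)) t by rw [h]
  have hp' := minrep_inX cs I (m⁻¹ * p)
  have hy := minrep_mem cs I (m⁻¹ * p)
  set p' := minrep cs I (m⁻¹ * p) with hp'def
  have hy' : p'⁻¹ * (m⁻¹ * p) ∈ par cs I := by
    simpa using (par cs I).inv_mem hy
  by_cases hc : p'⁻¹ * t * p' ∈ par cs I
  · have h1 : side cs p' t = 0 := by
      have := hp'.side _ _ hc
      rw [side_inv] at this
      simpa [mul_assoc] using this
    have h2 : side cs (m⁻¹ * p) t = 0 := by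
      rw [side_mul, hm.side _ _ ht, zero_add, inv_inv]
      have hr := par_conj cs ((par cs I).inv_mem hy') hc
      have := hp.side _ _ hr
      rw [side_inv] at this
      simpa [mul_assoc] using this
    rw [h1, h2]
  · have : m⁻¹ * p = p' * (p'⁻¹ * (m⁻¹ * p)) := by group
    rw [this, side_mul, side_par cs hy' _ hc, add_zero]

open Classical in
theorem card_proj {I J : Finset B} {m u : W} (hm : InX cs J m) (hu : u ∈ par cs J) :
    (Finset.univ.filter fun p : W => InX cs I p ∧ InX cs J (p⁻¹ * (m * u))).card =
    (Finset.univ.filter fun d : W => InX cs J d⁻¹ ∧ InX cs I (u * d)).card := by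
  have hback : ∀ p, InX cs I p → minrep cs I (m * minrep cs I (m⁻¹ * p)) = p := by
    intro p hp
    refine (eq_minrep cs hp ?_).symm
    have := (par cs I).inv_mem (minrep_mem cs I (m⁻¹ * p))
    simpa [mul_assoc] using this
  have hback' : ∀ p, InX cs I p → minrep cs I (m⁻¹ * minrep cs I (m * p)) = p := by
    intro p hp
    refine (eq_minrep cs hp ?_).symm
    have := (par cs I).inv_mem (minrep_mem cs I (m * p))
    simpa [mul_assoc] using this
  have hcond : ∀ p, InX cs J (p⁻¹ * (m * u)) ↔ Proj cs J (m⁻¹ * p) u := by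
    intro p
    rw [← inX_inv_mul_iff cs hu]
    simp [mul_assoc]
  have hcond' : ∀ p, Proj cs J p u ↔ InX cs J (u⁻¹ * p)⁻¹ := by
    intro p
    rw [← inX_inv_mul_iff cs hu]
    simp
  refine Finset.card_bij' (fun p _ => u⁻¹ * minrep cs I (m⁻¹ * p))
    (fun d _ => minrep cs I (m * (u * d))) ?_ ?_ ?_ ?_
  · intro p hp
    simp only [Finset.mem_filter, Finset.mem_univ, true_and] at hp ⊢
    rw [← hcond', ← proj_minrep cs hm hp.1, ← hcond, mul_inv_cancel_left]
    exact ⟨hp.2, minrep_inX cs _ _⟩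
  · intro d hd
    simp only [Finset.mem_filter, Finset.mem_univ, true_and] at hd ⊢
    refine ⟨minrep_inX cs _ _, ?_⟩
    rw [hcond, proj_minrep cs hm (minrep_inX cs _ _), hback' _ hd.2, hcond', inv_mul_cancel_left]
    exact hd.1
  · intro p hp
    simp only [Finset.mem_filter, Finset.mem_univ, true_and] at hp
    rw [mul_inv_cancel_left, hback _ hp.1]
  · intro d hd
    simp only [Finset.mem_filter, Finset.mem_univ, true_and] at hd
    rw [hback' _ hd.2, inv_mul_cancel_left]

open Classical in
/-- The subset `J ∩ dId⁻¹`. -/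
noncomputable def capSet (I J : Finset B) (d : W) : Finset B :=
  J.filter fun j => ∃ i ∈ I, d * cs.simple i * d⁻¹ = cs.simple j

theorem inX_mul_capSet {I J : Finset B} {u d : W} (hu : u ∈ par cs J) (hd : InX cs J d⁻¹) :
    InX cs I (u * d) ↔ InX cs I d ∧ InX cs (capSet cs I J d) u := by
  have hu' := (par cs J).inv_mem hu
  have hside := hd.side
  rw [inv_inv] at hside
  -- the case of a conjugate lying in the parabolic subgroup
  have hA : ∀ i ∈ I, d * cs.simple i * d⁻¹ ∈ par cs J →
      side cs d⁻¹ (cs.simple i) = 0 ∧ ∃ j ∈ capSet cs I J d, d * cs.simple i * d⁻¹ = cs.simple j := by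
    intro i hi hr
    refine ⟨by rw [side_inv]; exact hside _ hr, ?_⟩
    set r := d * cs.simple i * d⁻¹ with hrdef
    have hr1 : r ≠ 1 := by
      intro h
      have h2 : cs.simple i = 1 := by
        have := congrArg (fun x => d⁻¹ * x * d) h
        simpa [hrdef, mul_assoc] using this
      have := cs.length_simple i
      rw [h2, cs.length_one] at this
      omega
    obtain ⟨j, hj, hs⟩ := exists_simple_side cs hr hr1
    have hjp := simple_mem_par cs (J := J) hj
    have e1 : side cs (r * d) (cs.simple j) = 1 := by
      rw [side_mul, hs, hside, add_zero]
      simpa using par_conj cs ((par cs J).inv_mem hr) hjp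
    have e2 : r * d = d * cs.simple i := by simp [hrdef]
    rw [e2, side_mul, hside _ hjp, zero_add, side_simple] at e1
    have e3 : d⁻¹ * cs.simple j * d = cs.simple i := by
      by_contra hc
      rw [if_neg hc] at e1
      exact absurd e1 (by decide)
    have e4 : r = cs.simple j := by
      rw [hrdef, ← e3]
      group
    exact ⟨j, by rw [capSet, Finset.mem_filter]; exact ⟨hj, i, hi, e4⟩, e4⟩
  have hB : ∀ i, side cs (u * d)⁻¹ (cs.simple i) =
      side cs d⁻¹ (cs.simple i) + side cs u⁻¹ (d * cs.simple i * d⁻¹) := by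
    intro i
    rw [mul_inv_rev, side_mul, inv_inv]
  simp only [inX_iff, hB]
  constructor
  · intro h
    constructor
    · intro i hi
      by_cases hr : d * cs.simple i * d⁻¹ ∈ par cs J
      · exact (hA i hi hr).1
      · have := h i hi
        rwa [side_par cs hu' _ hr, add_zero] at this
    · intro j hj
      rw [capSet, Finset.mem_filter] at hj
      obtain ⟨hj, i, hi, e⟩ := hj
      have hr : d * cs.simple i * d⁻¹ ∈ par cs J := e ▸ simple_mem_par cs hj
      have := h i hi
      rwa [(hA i hi hr).1, zero_add, e] at this
  · rintro ⟨h1, h2⟩ i hi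
    rw [h1 i hi, zero_add]
    by_cases hr : d * cs.simple i * d⁻¹ ∈ par cs J
    · obtain ⟨-, j, hj, e⟩ := hA i hi hr
      rw [e]
      exact h2 j hj
    · exact side_par cs hu' _ hr

open Classical in
theorem card_solomon (I J : Finset B) (w : W) :
    (Finset.univ.filter fun p : W => InX cs I p ∧ InX cs J (p⁻¹ * w)).card =
    (Finset.univ.filter fun d : W =>
      (InX cs J d⁻¹ ∧ InX cs I d) ∧ InX cs (capSet cs I J d) w).card := by
  obtain ⟨u, hu, hm⟩ := exists_minrep cs J w
  have hw : w = (w * u) * u⁻¹ := by group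
  have hu' := (par cs J).inv_mem hu
  rw [hw, card_proj cs hm hu']
  congr 1
  ext d
  simp only [Finset.mem_filter, Finset.mem_univ, true_and, and_assoc]
  refine and_congr_right fun hd => ?_
  rw [inX_mul_capSet cs hu' hd, inX_mul_iff cs (K := capSet cs I J d) (Finset.filter_subset _ _) hm hu']

theorem exists_descent (D : Finset B) : ∃ u : W, ∀ i, side cs u⁻¹ (cs.simple i) = 0 ↔ i ∉ D := by
  obtain ⟨⟨u, hu⟩, hmax⟩ := Finite.exists_max (fun u : par cs D => cs.length u.1)
  refine ⟨u, fun i => ⟨fun h hi => ?_, fun hi => ?_⟩⟩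
  · rw [side_eq_zero_iff cs (cs.isReflection_simple i), cs.length_inv, ← cs.length_inv (_ * u⁻¹)] at h
    have := hmax ⟨u * cs.simple i, (par cs D).mul_mem hu (simple_mem_par cs hi)⟩
    simp at h this
    omega
  · exact side_par cs ((par cs D).inv_mem hu) _ fun h => hi (mem_of_simple_mem_par cs h)

open Classical in
theorem coeff_descentBasis (I : Finset B) (w : W) :
    (descentBasis cs I).coeff w = if InX cs I w then 1 else 0 := by
  rw [descentBasis, MonoidAlgebra.coeff_sum, Finsupp.finsetSum_apply, Finset.sum_eq_single w]
  · by_cases h : InX cs I w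
    · have h2 : ∀ i ∈ I, cs.length w < cs.length (w * cs.simple i) := h
      rw [if_pos h2, if_pos h]; simp
    · have h2 : ¬ ∀ i ∈ I, cs.length w < cs.length (w * cs.simple i) := h
      rw [if_neg h2, if_neg h]; simp
  · intro v _ hv
    split_ifs
    · simp [hv]
    · simp
  · intro h; exact absurd (Finset.mem_univ w) h

open Classical in
theorem coeff_mul_descentBasis (I J : Finset B) (w : W) :
    (descentBasis cs I * descentBasis cs J).coeff w =
      ((Finset.univ.filter fun p : W => InX cs I p ∧ InX cs J (p⁻¹ * w)).card : ℚ) := by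
  conv_lhs => rw [descentBasis]
  rw [Finset.sum_mul, MonoidAlgebra.coeff_sum, Finsupp.finsetSum_apply, Finset.card_filter,
    Nat.cast_sum]
  refine Finset.sum_congr rfl fun p _ => ?_
  by_cases h : InX cs I p
  · have h2 : ∀ i ∈ I, cs.length p < cs.length (p * cs.simple i) := h
    rw [if_pos h2, MonoidAlgebra.coeff_single_mul_apply, coeff_descentBasis]
    simp [h]
  · have h2 : ¬ ∀ i ∈ I, cs.length p < cs.length (p * cs.simple i) := h
    rw [if_neg h2]
    simp [h]

open Classical in
/-- Structure constants of the descent algebra. -/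
noncomputable def sc (I J K : Finset B) : ℚ :=
  ((Finset.univ.filter fun d : W => (InX cs J d⁻¹ ∧ InX cs I d) ∧ capSet cs I J d = K).card : ℚ)

theorem sc_nonneg (I J K : Finset B) : 0 ≤ sc cs I J K := Nat.cast_nonneg _

theorem sc_eq_zero {I J K : Finset B} (h : ¬ K ⊆ J) : sc cs I J K = 0 := by
  classical
  rw [sc, Nat.cast_eq_zero, Finset.card_eq_zero, Finset.filter_eq_empty_iff]
  rintro d - ⟨-, rfl⟩
  exact h (Finset.filter_subset _ _)

theorem descentBasis_mul (I J : Finset B) :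
    descentBasis cs I * descentBasis cs J = ∑ K : Finset B, sc cs I J K • descentBasis cs K := by
  classical
  ext w
  rw [coeff_mul_descentBasis, card_solomon, MonoidAlgebra.coeff_sum, Finsupp.finsetSum_apply]
  simp only [MonoidAlgebra.coeff_smul_apply, coeff_descentBasis, sc, Finset.card_filter, smul_eq_mul]
  push_cast
  simp only [Finset.sum_mul]
  rw [Finset.sum_comm]
  refine Finset.sum_congr rfl fun d _ => ?_
  rw [Finset.sum_eq_single (capSet cs I J d)]
  · by_cases h1 : InX cs J d⁻¹ ∧ InX cs I d <;> by_cases h2 : InX cs (capSet cs I J d) w <;>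
      simp [h1, h2]
  · intro K _ hK
    simp [Ne.symm hK]
  · intro h; exact absurd (Finset.mem_univ _) h

theorem descentBasis_indep (b : Finset B → ℚ)
    (h : ∑ K : Finset B, b K • descentBasis cs K = 0) : ∀ K, b K = 0 := by
  classical
  intro K
  induction K using Finset.strongInduction with
  | H K ih =>
    obtain ⟨u, hu⟩ := exists_descent cs (Finset.univ \ K)
    have hX : ∀ L, InX cs L u ↔ L ⊆ K := by
      intro L
      rw [inX_iff]
      simp only [hu]
      constructor
      · intro h i hi
        simpa using h i hi
      · intro h i hi
        simpa using h hi
    have h1 := congrArg (fun x : MonoidAlgebra ℚ W => x.coeff u) h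
    simp only [MonoidAlgebra.coeff_sum, Finsupp.finsetSum_apply, MonoidAlgebra.coeff_smul_apply,
      coeff_descentBasis, hX] at h1
    rw [Finset.sum_eq_single K] at h1
    · simpa using h1
    · intro L _ hL
      by_cases hLK : L ⊆ K
      · rw [ih L (Finset.ssubset_iff_subset_ne.mpr ⟨hLK, hL⟩), zero_smul]
      · simp [hLK]
    · intro h; exact absurd (Finset.mem_univ _) h

theorem descentBasis_inj {b b' : Finset B → ℚ}
    (h : ∑ K : Finset B, b K • descentBasis cs K = ∑ K : Finset B, b' K • descentBasis cs K) :
    b = b' := by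
  funext K
  have := descentBasis_indep cs (fun K => b K - b' K) (by
    simp only [sub_smul, Finset.sum_sub_distrib, h, sub_self]) K
  exact sub_eq_zero.mp this

theorem descentBasis_univ : descentBasis cs Finset.univ = 1 := by
  classical
  ext w
  rw [coeff_descentBasis, MonoidAlgebra.one_def, MonoidAlgebra.coeff_single, Finsupp.single_apply]
  congr 1
  apply propext
  constructor
  · intro h
    by_contra hc
    obtain ⟨i, hi⟩ := cs.exists_rightDescent_of_ne_one (Ne.symm hc)
    have := h i (Finset.mem_univ i)
    unfold CoxeterSystem.IsRightDescent at hi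
    omega
  · rintro rfl i _
    simp

theorem sum_ite_basis (I : Finset B) :
    ∑ K : Finset B, (if K = I then (1 : ℚ) else 0) • descentBasis cs K = descentBasis cs I := by
  simp [ite_smul]

theorem sc_univ_right (I K : Finset B) : sc cs I Finset.univ K = if K = I then 1 else 0 := by
  have h := descentBasis_mul cs I Finset.univ
  rw [descentBasis_univ, mul_one, ← sum_ite_basis cs I] at h
  exact (congrFun (descentBasis_inj cs h) K).symm

theorem sc_univ_left (J K : Finset B) : sc cs Finset.univ J K = if K = J then 1 else 0 := by
  have h := descentBasis_mul cs Finset.univ J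
  rw [descentBasis_univ, one_mul, ← sum_ite_basis cs J] at h
  exact (congrFun (descentBasis_inj cs h) K).symm

theorem sum_mul_sum_basis (c b : Finset B → ℚ) :
    (∑ I : Finset B, c I • descentBasis cs I) * (∑ J : Finset B, b J • descentBasis cs J) =
      ∑ K : Finset B, (∑ J : Finset B, b J * ∑ I : Finset B, c I * sc cs I J K) •
        descentBasis cs K := by
  rw [Finset.sum_mul_sum, Finset.sum_comm]
  simp only [Finset.sum_smul, Finset.mul_sum]
  rw [Finset.sum_comm (s := (Finset.univ : Finset (Finset B))) (t := Finset.univ)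
    (f := fun K J => ∑ I : Finset B, (b J * (c I * sc cs I J K)) • descentBasis cs K)]
  refine Finset.sum_congr rfl fun J _ => ?_
  rw [Finset.sum_comm]
  refine Finset.sum_congr rfl fun I _ => ?_
  rw [smul_mul_smul_comm, descentBasis_mul, Finset.smul_sum]
  refine Finset.sum_congr rfl fun K _ => ?_
  rw [smul_smul]
  congr 1
  ring

theorem left_injective (c : Finset B → ℚ) (hc : ∀ I, 0 ≤ c I) (hpos : 0 < c Finset.univ)
    (b : Finset B → ℚ)
    (h : (∑ I : Finset B, c I • descentBasis cs I) * (∑ J : Finset B, b J • descentBasis cs J) = 0) :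
    ∀ J, b J = 0 := by
  classical
  rw [sum_mul_sum_basis] at h
  have h0 := descentBasis_indep cs _ h
  by_contra! hne
  obtain ⟨J₀, hJ₀⟩ := hne
  obtain ⟨J, hJ, hmax⟩ := Finset.exists_max_image
    (Finset.univ.filter fun J : Finset B => b J ≠ 0) Finset.card ⟨J₀, by simpa using hJ₀⟩
  simp only [Finset.mem_filter, Finset.mem_univ, true_and] at hJ hmax
  have h1 := h0 J
  rw [Finset.sum_eq_single J] at h1
  · have h2 : 0 < ∑ I : Finset B, c I * sc cs I J J := by
      refine Finset.sum_pos' (fun I _ => mul_nonneg (hc I) (sc_nonneg cs I J J))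
        ⟨Finset.univ, Finset.mem_univ _, ?_⟩
      rw [sc_univ_left, if_pos rfl, mul_one]
      exact hpos
    exact (mul_ne_zero hJ h2.ne') h1
  · intro L _ hL
    by_cases hb : b L = 0
    · rw [hb, zero_mul]
    · have hns : ¬ J ⊆ L := fun hs => hL (Finset.eq_of_subset_of_card_le hs (hmax L hb)).symm
      simp [sc_eq_zero cs hns]
  · intro h; exact absurd (Finset.mem_univ _) h

theorem not_unit (c b : Finset B → ℚ) (h0 : c Finset.univ = 0) :
    (∑ I : Finset B, c I • descentBasis cs I) * (∑ J : Finset B, b J • descentBasis cs J) ≠ 1 := by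
  intro h
  rw [sum_mul_sum_basis, ← descentBasis_univ cs, ← sum_ite_basis cs Finset.univ] at h
  have h1 := congrFun (descentBasis_inj cs h) Finset.univ
  rw [Finset.sum_eq_single Finset.univ] at h1
  · simp [sc_univ_right, h0] at h1
  · intro L _ hL
    have hns : ¬ (Finset.univ : Finset B) ⊆ L := fun hs => hL (Finset.univ_subset_iff.mp hs)
    simp [sc_eq_zero cs hns]
  · intro h; exact absurd (Finset.mem_univ _) h

end DescentAux

set_option synthInstance.maxHeartbeats 1000000 in
set_option maxHeartbeats 1000000 in
/-- A nonnegative element `a = Σ_I c_I x_I` (all `c_I ≥ 0`) of the descent algebra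
`Σ(W)` is invertible in `Σ(W)` if and only if `ξ_S(a) = c_S > 0`. -/
theorem pos_element_invertible_iff {M : CoxeterMatrix B}
    (cs : CoxeterSystem M W) (A : Subalgebra ℚ (MonoidAlgebra ℚ W))
    (hA : IsDescentAlgebra cs A) (a : MonoidAlgebra ℚ W) (c : Finset B → ℚ)
    (hc : ∀ I, 0 ≤ c I) (ha : a = ∑ I : Finset B, c I • descentBasis cs I) :
    (∃ b ∈ A, a * b = 1 ∧ b * a = 1) ↔ 0 < c Finset.univ := by
  have hmem : ∀ b, b ∈ A ↔ ∃ f : Finset B → ℚ, ∑ K, f K • descentBasis cs K = b := by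
    intro b
    rw [← SetLike.mem_coe, hA, SetLike.mem_coe, Submodule.mem_span_range_iff_exists_fun]
  constructor
  · rintro ⟨b, hb, hab, -⟩
    obtain ⟨f, rfl⟩ := (hmem b).mp hb
    refine lt_of_le_of_ne (hc _) fun h0 => ?_
    rw [ha] at hab
    exact DescentAux.not_unit cs c f h0.symm hab
  · intro hpos
    have haA : a ∈ A := (hmem a).mpr ⟨c, ha.symm⟩
    have hinj : ∀ b ∈ A, a * b = 0 → b = 0 := by
      intro b hb hab
      obtain ⟨f, rfl⟩ := (hmem b).mp hb
      rw [ha] at hab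
      have := DescentAux.left_injective cs c hc hpos f hab
      simp [this]
    let V : Submodule ℚ (MonoidAlgebra ℚ W) := Submodule.span ℚ (Set.range (descentBasis cs))
    have hV : ∀ b, b ∈ V ↔ b ∈ A := by
      intro b
      exact (Set.ext_iff.mp hA b).symm
    have hfin : FiniteDimensional ℚ V := FiniteDimensional.span_of_finite ℚ (Set.finite_range _)
    let L : V →ₗ[ℚ] V := (LinearMap.mulLeft ℚ a).restrict (p := V) (q := V) (by
      intro x hx
      rw [hV] at hx ⊢
      exact A.mul_mem haA hx)
    have hL : Function.Injective L := by
      rw [injective_iff_map_eq_zero]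
      intro x hx
      have hx' : a * (x : MonoidAlgebra ℚ W) = 0 := congrArg Subtype.val hx
      exact Subtype.ext (hinj _ ((hV _).mp x.2) hx')
    obtain ⟨b, hb⟩ := LinearMap.injective_iff_surjective.mp hL ⟨1, (hV 1).mpr A.one_mem⟩
    have hb' : a * (b : MonoidAlgebra ℚ W) = 1 := congrArg Subtype.val hb
    have hbA := (hV _).mp b.2
    refine ⟨b, hbA, hb', ?_⟩
    have h := hinj ((b : MonoidAlgebra ℚ W) * a - 1)
      (A.sub_mem (A.mul_mem hbA haA) A.one_mem) (by
        rw [mul_sub, ← mul_assoc, hb', one_mul, mul_one, sub_self])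
    exact sub_eq_zero.mp h
end

section
/- Let a₁,…,a_r be nonnegative elements of the descent algebra Σ(W). Then the right ideal generated by their sum equals the sum of their right ideals: a₁Σ(W) + ⋯ + a_rΣ(W) = (a₁+⋯+a_r)Σ(W). -/
open MonoidAlgebra

variable {B W : Type*} [DecidableEq B] [Fintype B] [Group W] [Fintype W] [DecidableEq W]

section Helpers

variable {M : CoxeterMatrix B} (cs : CoxeterSystem M W)

/-- The generator action on `W × ℤ/2`. -/
def stepEnd (i : B) : Function.End (W × ZMod 2) :=
  fun p => (cs.simple i * p.1 * (cs.simple i)⁻¹, p.2 + if p.1 = cs.simple i then 1 else 0)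

theorem simple_mul_pow_aux (i j : B) (n : ℕ) :
    cs.simple j * (cs.simple i * cs.simple j) ^ n =
      ((cs.simple i * cs.simple j) ^ n)⁻¹ * cs.simple j := by
  induction n with
  | zero => simp
  | succ n ih =>
    rw [pow_succ, ← mul_assoc, ih, ← pow_succ, pow_succ' (cs.simple i * cs.simple j) n]
    simp [mul_assoc]

theorem conj_pow_eq_iff (i j : B) (n : ℕ) (t : W) :
    (cs.simple i * cs.simple j) ^ n * t * ((cs.simple i * cs.simple j) ^ n)⁻¹ = cs.simple j ↔
      (cs.simple i * cs.simple j) ^ (2 * n) * t = cs.simple j := by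
  rw [mul_inv_eq_iff_eq_mul, simple_mul_pow_aux, two_mul, pow_add, mul_assoc _ _ t,
    eq_inv_mul_iff_mul_eq]

theorem conj_pow_eq_iff2 (i j : B) (n : ℕ) (t : W) :
    cs.simple j * ((cs.simple i * cs.simple j) ^ n * t * ((cs.simple i * cs.simple j) ^ n)⁻¹)
        * (cs.simple j)⁻¹ = cs.simple i ↔
      (cs.simple i * cs.simple j) ^ (2 * n + 1) * t = cs.simple j := by
  rw [mul_inv_eq_iff_eq_mul, ← eq_inv_mul_iff_mul_eq, mul_inv_eq_iff_eq_mul]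
  have h : (cs.simple j)⁻¹ * (cs.simple i * cs.simple j) * (cs.simple i * cs.simple j) ^ n =
      ((cs.simple i * cs.simple j) ^ (n + 1))⁻¹ * cs.simple j := by
    rw [← simple_mul_pow_aux, pow_succ']
    simp [mul_assoc]
  rw [h, eq_inv_mul_iff_mul_eq, ← mul_assoc, ← pow_add]
  have : n + 1 + n = 2 * n + 1 := by ring
  rw [this]

theorem stepEnd_pow (i j : B) (n : ℕ) (t : W) (e : ZMod 2) :
    ((stepEnd cs i * stepEnd cs j) ^ n) (t, e) =
      ((cs.simple i * cs.simple j) ^ n * t * ((cs.simple i * cs.simple j) ^ n)⁻¹,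
        e + ∑ l ∈ Finset.range (2 * n),
          if (cs.simple i * cs.simple j) ^ l * t = cs.simple j then 1 else 0) := by
  induction n with
  | zero => simp; rfl
  | succ n ih =>
    rw [pow_succ']
    change stepEnd cs i (stepEnd cs j (((stepEnd cs i * stepEnd cs j) ^ n) (t, e))) = _
    rw [ih]
    have e2 : 2 * (n + 1) = 2 * n + 1 + 1 := by ring
    rw [e2, Finset.sum_range_succ, Finset.sum_range_succ]
    simp only [stepEnd, conj_pow_eq_iff, conj_pow_eq_iff2]
    refine Prod.ext ?_ ?_
    · simp only [pow_succ', mul_inv_rev, mul_assoc]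
    · simp only [add_assoc]

theorem stepEnd_liftable : M.IsLiftable (stepEnd cs) := by
  intro i j
  funext p
  obtain ⟨t, e⟩ := p
  rw [stepEnd_pow]
  have hm := cs.simple_mul_simple_pow i j
  change _ = (t, e)
  refine Prod.ext ?_ ?_
  · simp [hm]
  · rw [two_mul, Finset.sum_range_add]
    simp only [pow_add, hm, one_mul]
    rw [CharTwo.add_self_eq_zero, add_zero]

/-- The inversion cocycle. -/
noncomputable def eta (w t : W) : ZMod 2 := (cs.lift ⟨stepEnd cs, stepEnd_liftable cs⟩ w (t, 0)).2

theorem lift_apply_eta (w t : W) (e : ZMod 2) :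
    cs.lift ⟨stepEnd cs, stepEnd_liftable cs⟩ w (t, e) = (w * t * w⁻¹, e + eta cs w t) := by
  suffices h : ∃ f : W → ZMod 2, ∀ t e,
      cs.lift ⟨stepEnd cs, stepEnd_liftable cs⟩ w (t, e) = (w * t * w⁻¹, e + f t) by
    obtain ⟨f, hf⟩ := h
    rw [eta, hf, hf]
    simp
  induction w using cs.simple_induction_left with
  | one =>
    refine ⟨fun _ => 0, fun t e => ?_⟩
    rw [map_one]
    simp
    rfl
  | mul_simple_left w i ih =>
    obtain ⟨f, hf⟩ := ih
    refine ⟨fun t => f t + if w * t * w⁻¹ = cs.simple i then 1 else 0, fun t e => ?_⟩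
    rw [map_mul]
    change cs.lift ⟨stepEnd cs, stepEnd_liftable cs⟩ (cs.simple i)
      (cs.lift ⟨stepEnd cs, stepEnd_liftable cs⟩ w (t, e)) = _
    rw [hf, cs.lift_apply_simple]
    simp [stepEnd, mul_assoc, add_assoc]

theorem eta_mul (u v t : W) : eta cs (u * v) t = eta cs v t + eta cs u (v * t * v⁻¹) := by
  have h : cs.lift ⟨stepEnd cs, stepEnd_liftable cs⟩ (u * v) (t, 0) =
      cs.lift ⟨stepEnd cs, stepEnd_liftable cs⟩ u
        (cs.lift ⟨stepEnd cs, stepEnd_liftable cs⟩ v (t, 0)) := by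
    rw [map_mul]; rfl
  rw [lift_apply_eta, lift_apply_eta, lift_apply_eta] at h
  simpa using congrArg Prod.snd h

theorem eta_simple (i : B) (t : W) :
    eta cs (cs.simple i) t = if t = cs.simple i then 1 else 0 := by
  rw [eta, cs.lift_apply_simple]
  simp [stepEnd]

theorem eta_one (t : W) : eta cs 1 t = 0 := by
  have := eta_mul cs 1 1 t
  simpa using this

theorem eta_inv (w t : W) : eta cs w⁻¹ (w * t * w⁻¹) = eta cs w t := by
  have h := eta_mul cs w⁻¹ w t
  rw [inv_mul_cancel, eta_one] at h
  exact (CharTwo.add_eq_zero.mp h.symm).symm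

theorem zmod2_ne (x : ZMod 2) : x ≠ 0 ↔ x = 1 := by
  revert x; decide

theorem eta_self {t : W} (ht : cs.IsReflection t) : eta cs t t = 1 := by
  obtain ⟨w, i, rfl⟩ := ht
  rw [eta_mul, eta_inv, eta_mul]
  have : w⁻¹ * (w * cs.simple i * w⁻¹) * w⁻¹⁻¹ = cs.simple i := by group
  rw [this, eta_simple]
  have h2 : cs.simple i * cs.simple i * (cs.simple i)⁻¹ = cs.simple i := by group
  rw [h2, if_pos rfl, add_left_comm, CharTwo.add_self_eq_zero, add_zero]

theorem mem_ris_of_eta (ω : List B) (t : W) (h : eta cs (cs.wordProd ω) t = 1) :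
    t ∈ cs.rightInvSeq ω := by
  induction ω with
  | nil => simp [eta_one] at h
  | cons i ω ih =>
    rw [cs.wordProd_cons, eta_mul, eta_simple] at h
    rw [CoxeterSystem.rightInvSeq, List.mem_cons]
    by_cases h1 : cs.wordProd ω * t * (cs.wordProd ω)⁻¹ = cs.simple i
    · left
      rw [← h1]; group
    · right
      rw [if_neg h1, add_zero] at h
      exact ih h

theorem lt_of_eta {w t : W} (h : eta cs w t = 1) : cs.length (w * t) < cs.length w := by
  obtain ⟨ω, hω, rfl⟩ := cs.exists_isReduced w
  exact (cs.isRightInversion_of_mem_rightInvSeq hω (mem_ris_of_eta cs ω t h)).2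

theorem eta_eq_zero_iff {w t : W} (ht : cs.IsReflection t) :
    eta cs w t = 0 ↔ cs.length w < cs.length (w * t) := by
  constructor
  · intro h
    have h1 : eta cs (w * t) t = 1 := by
      rw [eta_mul, eta_self cs ht]
      simp [h]
    have := lt_of_eta cs h1
    rwa [mul_assoc, ht.mul_self, mul_one] at this
  · intro h
    by_contra h0
    have := lt_of_eta cs ((zmod2_ne _).mp h0)
    omega

/-- Standard parabolic subgroup. -/
def parab (J : Finset B) : Subgroup W := Subgroup.closure (cs.simple '' (J : Set B))

theorem simple_mem_parab {J : Finset B} {i : B} (hi : i ∈ J) : cs.simple i ∈ parab cs J :=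
  Subgroup.subset_closure ⟨i, hi, rfl⟩

theorem mem_parab_of_eta {J : Finset B} {g : W} (hg : g ∈ parab cs J) :
    ∀ t, eta cs g t ≠ 0 → t ∈ parab cs J := by
  induction hg using Subgroup.closure_induction with
  | mem x hx =>
    obtain ⟨i, hi, rfl⟩ := hx
    intro t ht
    rw [eta_simple] at ht
    by_cases h : t = cs.simple i
    · rw [h]; exact simple_mem_parab cs hi
    · simp [h] at ht
  | one => intro t ht; exact absurd (eta_one cs t) ht
  | mul u v hu hv ihu ihv =>
    intro t ht
    rw [eta_mul] at ht
    by_cases h : eta cs v t = 0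
    · rw [h, zero_add] at ht
      have := ihu _ ht
      have h2 := (parab cs J).mul_mem ((parab cs J).mul_mem ((parab cs J).inv_mem hv) this) hv
      have e : v⁻¹ * (v * t * v⁻¹) * v = t := by group
      rwa [e] at h2
    · exact ihv _ h
  | inv v hv ih =>
    intro t ht
    have e : v * (v⁻¹ * t * v) * v⁻¹ = t := by group
    rw [← e, eta_inv] at ht
    have h2 := (parab cs J).mul_mem ((parab cs J).mul_mem hv (ih _ ht)) ((parab cs J).inv_mem hv)
    rwa [e] at h2

theorem exists_reduced_parab {J : Finset B} {g : W} (hg : g ∈ parab cs J) :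
    ∃ ω : List B, (∀ i ∈ ω, i ∈ J) ∧ cs.IsReduced ω ∧ cs.wordProd ω = g := by
  have key : ∀ (x : W) (i : B), i ∈ J →
      (∃ ω : List B, (∀ i ∈ ω, i ∈ J) ∧ cs.IsReduced ω ∧ cs.wordProd ω = x) →
      ∃ ω : List B, (∀ i ∈ ω, i ∈ J) ∧ cs.IsReduced ω ∧ cs.wordProd ω = x * cs.simple i := by
    rintro x i hi ⟨ω, h1, h2, rfl⟩
    by_cases h : eta cs (cs.wordProd ω) (cs.simple i) = 0
    · refine ⟨ω ++ [i], ?_, ?_, ?_⟩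
      · intro k hk
        simp only [List.mem_append, List.mem_singleton] at hk
        rcases hk with hk | rfl
        · exact h1 k hk
        · exact hi
      · have := (eta_eq_zero_iff cs (cs.isReflection_simple i)).mp h
        have h3 := cs.length_mul_simple (cs.wordProd ω) i
        have h4 := h2.eq
        unfold CoxeterSystem.IsReduced
        rw [cs.wordProd_append, cs.wordProd_singleton, List.length_append, List.length_singleton]
        omega
      · rw [cs.wordProd_append, cs.wordProd_singleton]
    · have h5 := lt_of_eta cs ((zmod2_ne _).mp h)
      have h6 := mem_ris_of_eta cs ω _ ((zmod2_ne _).mp h)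
      obtain ⟨n, hn, hn2⟩ := List.mem_iff_getElem.mp h6
      have h7 := cs.wordProd_mul_getD_rightInvSeq ω n
      rw [List.getD_eq_getElem _ _ hn, hn2] at h7
      rw [cs.length_rightInvSeq] at hn
      refine ⟨ω.eraseIdx n, fun k hk => h1 k (List.mem_of_mem_eraseIdx hk), ?_, h7.symm⟩
      unfold CoxeterSystem.IsReduced
      have h3 := cs.length_mul_simple (cs.wordProd ω) i
      have h4 := h2.eq
      rw [← h7, List.length_eraseIdx_of_lt hn]
      omega
  induction hg using Subgroup.closure_induction_right with
  | one => exact ⟨[], by simp, by simp [CoxeterSystem.IsReduced], by simp⟩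
  | mul_right x hx y hy ih =>
    obtain ⟨i, hi, rfl⟩ := hy
    exact key x i hi ih
  | mul_inv_cancel x hx y hy ih =>
    obtain ⟨i, hi, rfl⟩ := hy
    rw [cs.inv_simple]
    exact key x i hi ih

theorem exists_simple_of_mem {J : Finset B} {k : B} (hk : cs.simple k ∈ parab cs J) :
    ∃ i ∈ J, cs.simple k = cs.simple i := by
  obtain ⟨ω, h1, h2, h3⟩ := exists_reduced_parab cs hk
  have h4 := h2.eq
  rw [h3, cs.length_simple] at h4
  obtain ⟨i, rfl⟩ := List.length_eq_one_iff.mp h4.symm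
  refine ⟨i, h1 i (by simp), ?_⟩
  rw [← h3, cs.wordProd_singleton]

theorem exists_descent {J : Finset B} {g : W} (hg : g ∈ parab cs J) (h1 : g ≠ 1) :
    ∃ i ∈ J, eta cs g (cs.simple i) = 1 := by
  obtain ⟨k, hk⟩ := cs.exists_rightDescent_of_ne_one h1
  have h : eta cs g (cs.simple k) = 1 := by
    rw [← zmod2_ne]
    intro h0
    have := (eta_eq_zero_iff cs (cs.isReflection_simple k)).mp h0
    unfold CoxeterSystem.IsRightDescent at hk
    omega
  obtain ⟨i, hi, e⟩ := exists_simple_of_mem cs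
    (mem_parab_of_eta cs hg _ ((zmod2_ne _).mpr h))
  exact ⟨i, hi, e ▸ h⟩

theorem exists_min (J : Finset B) (w : W) : ∃ m g, g ∈ parab cs J ∧ w = m * g ∧
    ∀ t ∈ parab cs J, cs.IsReflection t → eta cs m t = 0 := by
  obtain ⟨g, hg, hmin⟩ := Set.exists_min_image (parab cs J : Set W)
    (fun g => cs.length (w * g)) (Set.toFinite _) ⟨1, (parab cs J).one_mem⟩
  refine ⟨w * g, g⁻¹, (parab cs J).inv_mem hg, by group, fun t ht hr => ?_⟩
  by_contra h0
  have h1 := lt_of_eta cs ((zmod2_ne _).mp h0)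
  have h2 := hmin (g * t) ((parab cs J).mul_mem hg ht)
  simp only [← mul_assoc] at h2
  omega

theorem eta_zero_of_min {J : Finset B} {u : W} (hu : ∀ i ∈ J, eta cs u (cs.simple i) = 0) :
    ∀ t ∈ parab cs J, cs.IsReflection t → eta cs u t = 0 := by
  obtain ⟨m, g, hg, rfl, hm⟩ := exists_min cs J u
  by_cases h1 : g = 1
  · simpa [h1] using hm
  · obtain ⟨i, hi, h⟩ := exists_descent cs hg h1
    have h2 := hu i hi
    rw [eta_mul, h, hm _ ((parab cs J).mul_mem ((parab cs J).mul_mem hg (simple_mem_parab cs hi))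
      ((parab cs J).inv_mem hg)) ((cs.isReflection_simple i).conj g)] at h2
    simp at h2

/-- Minimal coset representatives. -/
noncomputable def XS (J : Finset B) : Finset W :=
  Finset.univ.filter fun w => ∀ i ∈ J, eta cs w (cs.simple i) = 0

theorem mem_XS {J : Finset B} {w : W} :
    w ∈ XS cs J ↔ ∀ i ∈ J, eta cs w (cs.simple i) = 0 := by simp [XS]

theorem exists_decomp (J : Finset B) (w : W) :
    ∃ u g, u ∈ XS cs J ∧ g ∈ parab cs J ∧ w = u * g := by
  obtain ⟨m, g, hg, rfl, hm⟩ := exists_min cs J w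
  refine ⟨m, g, ?_, hg, rfl⟩
  rw [mem_XS]
  exact fun i hi => hm _ (simple_mem_parab cs hi) (cs.isReflection_simple i)

theorem decomp_unique {J : Finset B} {u g u' g' : W} (hu : u ∈ XS cs J) (hu' : u' ∈ XS cs J)
    (hg : g ∈ parab cs J) (hg' : g' ∈ parab cs J) (h : u * g = u' * g') : u = u' := by
  rw [mem_XS] at hu hu'
  have hk : g * g'⁻¹ ∈ parab cs J := (parab cs J).mul_mem hg ((parab cs J).inv_mem hg')
  have e : u' = u * (g * g'⁻¹) := by rw [← mul_assoc, h]; group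
  by_cases h1 : g * g'⁻¹ = 1
  · rw [e, h1, mul_one]
  · exfalso
    obtain ⟨i, hi, h⟩ := exists_descent cs hk h1
    have h2 := hu' i hi
    rw [e, eta_mul, h, eta_zero_of_min cs hu _ ((parab cs J).mul_mem
      ((parab cs J).mul_mem hk (simple_mem_parab cs hi))
      ((parab cs J).inv_mem hk)) ((cs.isReflection_simple i).conj _)] at h2
    simp at h2

/-- `K ∩ d⁻¹ J d`. -/
noncomputable def conjSet (J K : Finset B) (d : W) : Finset B :=
  K.filter fun k => ∃ i ∈ J, d * cs.simple k * d⁻¹ = cs.simple i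

/-- Minimal double coset representatives. -/
noncomputable def XX (J K : Finset B) : Finset W :=
  Finset.univ.filter fun d => d ∈ XS cs K ∧ d⁻¹ ∈ XS cs J

theorem mackey_mem1 {J K : Finset B} {u g d : W} (hu : u ∈ XS cs J) (hv : g * d ∈ XS cs K)
    (hg : g ∈ parab cs J) (hd : d⁻¹ ∈ XS cs J) :
    d ∈ XX cs J K ∧ u * (g * d) ∈ XS cs (conjSet cs J K d) := by
  rw [mem_XS] at hu hv
  constructor
  · simp only [XX, Finset.mem_filter, Finset.mem_univ, true_and, hd, and_true]
    rw [mem_XS] at hd ⊢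
    intro k hk
    by_contra h0
    have h1 := hv k hk
    rw [eta_mul, (zmod2_ne _).mp h0] at h1
    have h2 : eta cs g (d * cs.simple k * d⁻¹) ≠ 0 := by
      intro h; rw [h] at h1; simp at h1
    have h3 := eta_zero_of_min cs hd _ (mem_parab_of_eta cs hg _ h2)
      ((cs.isReflection_simple k).conj d)
    rw [eta_inv] at h3
    exact h0 h3
  · rw [mem_XS]
    intro k hk
    obtain ⟨hk, i, hi, e⟩ := Finset.mem_filter.mp hk
    rw [eta_mul, hv k hk, zero_add]
    have e2 : g * d * cs.simple k * (g * d)⁻¹ = g * cs.simple i * g⁻¹ := by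
      rw [← e]; group
    rw [e2]
    exact eta_zero_of_min cs hu _ ((parab cs J).mul_mem
      ((parab cs J).mul_mem hg (simple_mem_parab cs hi))
      ((parab cs J).inv_mem hg)) ((cs.isReflection_simple i).conj _)

theorem mackey_mem2 {J K : Finset B} {u g d : W} (hd : d ∈ XX cs J K)
    (hw : u * (g * d) ∈ XS cs (conjSet cs J K d)) (hu : u ∈ XS cs J) (hg : g ∈ parab cs J) :
    g * d ∈ XS cs K := by
  simp only [XX, Finset.mem_filter, Finset.mem_univ, true_and] at hd
  obtain ⟨hd1, hd2⟩ := hd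
  rw [mem_XS] at *
  intro k hk
  by_contra h0
  rw [eta_mul, hd1 k hk, zero_add] at h0
  have ht := mem_parab_of_eta cs hg _ h0
  have hr := (cs.isReflection_simple k).conj d
  have hne : d * cs.simple k * d⁻¹ ≠ 1 := by
    intro h
    have := eta_self cs hr
    rw [h, eta_one] at this
    simp at this
  obtain ⟨i, hi, h⟩ := exists_descent cs ht hne
  have e1 : d⁻¹ * (d * cs.simple k * d⁻¹) = cs.simple k * d⁻¹ := by group
  have h1 : eta cs (d⁻¹ * (d * cs.simple k * d⁻¹)) (cs.simple i) = 1 := by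
    rw [eta_mul, h, eta_zero_of_min cs hd2 _ ((parab cs J).mul_mem
      ((parab cs J).mul_mem ht (simple_mem_parab cs hi))
      ((parab cs J).inv_mem ht)) ((cs.isReflection_simple i).conj _), add_zero]
  rw [e1, eta_mul, hd2 i hi, zero_add, eta_simple] at h1
  have e2 : d⁻¹ * cs.simple i * d⁻¹⁻¹ = cs.simple k := by
    by_contra hn
    rw [if_neg hn] at h1
    exact zero_ne_one h1
  have e3 : d * cs.simple k * d⁻¹ = cs.simple i := by rw [← e2]; group
  have h2 := hw k (Finset.mem_filter.mpr ⟨hk, i, hi, e3⟩)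
  rw [eta_mul, eta_mul, hd1 k hk, zero_add] at h2
  have e4 : g * d * cs.simple k * (g * d)⁻¹ = g * cs.simple i * g⁻¹ := by
    rw [← e3]; group
  rw [e4, eta_zero_of_min cs hu _ ((parab cs J).mul_mem
      ((parab cs J).mul_mem hg (simple_mem_parab cs hi))
      ((parab cs J).inv_mem hg)) ((cs.isReflection_simple i).conj _), add_zero] at h2
  exact h0 h2

theorem descentBasis_eq (I : Finset B) :
    descentBasis cs I = ∑ w ∈ XS cs I, MonoidAlgebra.single w (1 : ℚ) := by
  rw [descentBasis, XS, Finset.sum_filter]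
  refine Finset.sum_congr rfl fun w _ => ?_
  have : (∀ i ∈ I, cs.length w < cs.length (w * cs.simple i)) ↔
      ∀ i ∈ I, eta cs w (cs.simple i) = 0 :=
    forall₂_congr fun i _ => (eta_eq_zero_iff cs (cs.isReflection_simple i)).symm
  by_cases h : ∀ i ∈ I, cs.length w < cs.length (w * cs.simple i)
  · rw [if_pos h, if_pos (this.mp h)]
  · rw [if_neg h, if_neg (fun h' => h (this.mpr h'))]

theorem mackey (J K : Finset B) : descentBasis cs J * descentBasis cs K =
    ∑ d ∈ XX cs J K, descentBasis cs (conjSet cs J K d) := by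
  simp only [descentBasis_eq]
  rw [Finset.sum_mul_sum, ← Finset.sum_product', Finset.sum_sigma']
  have hdec : ∀ v : W, ∃ d g, d⁻¹ ∈ XS cs J ∧ g ∈ parab cs J ∧ v = g * d := by
    intro v
    obtain ⟨u, g, hu, hg, e⟩ := exists_decomp cs J v⁻¹
    refine ⟨u⁻¹, g⁻¹, by simpa using hu, (parab cs J).inv_mem hg, ?_⟩
    rw [← mul_inv_rev, ← e, inv_inv]
  choose D G hD hG hE using hdec
  refine Finset.sum_bij (fun p _ => ⟨D p.2, p.1 * p.2⟩) ?_ ?_ ?_ ?_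
  · rintro ⟨u, v⟩ h
    obtain ⟨hu, hv⟩ := Finset.mem_product.mp h
    simp only at hu hv
    rw [hE v] at hv
    have := mackey_mem1 cs hu hv (hG v) (hD v)
    rw [← hE v] at this
    exact Finset.mem_sigma.mpr this
  · rintro ⟨u, v⟩ h ⟨u', v'⟩ h' e
    obtain ⟨hu, hv⟩ := Finset.mem_product.mp h
    obtain ⟨hu', hv'⟩ := Finset.mem_product.mp h'
    simp only at hu hv hu' hv'
    simp only [Sigma.mk.injEq, heq_eq_eq] at e
    obtain ⟨e1, e2⟩ := e
    have e3 : u * G v = u' * G v' := by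
      have a1 := hE v
      have a2 := hE v'
      have : u * (G v * D v) = u' * (G v' * D v') := by rw [← a1, ← a2, e2]
      rw [e1, ← mul_assoc, ← mul_assoc] at this
      exact mul_right_cancel this
    have e4 := decomp_unique cs hu hu' (hG v) (hG v') e3
    subst e4
    rw [mul_left_cancel e2]
  · rintro ⟨d, w⟩ h
    obtain ⟨hd, hw⟩ := Finset.mem_sigma.mp h
    simp only at hd hw
    obtain ⟨u, g, hu, hg, e⟩ := exists_decomp cs J (w * d⁻¹)
    have ew : w = u * (g * d) := by rw [← mul_assoc, ← e]; group
    rw [ew] at hw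
    have hv := mackey_mem2 cs hd hw hu hg
    refine ⟨(u, g * d), Finset.mem_product.mpr ⟨hu, hv⟩, ?_⟩
    have hd2 : d⁻¹ ∈ XS cs J := by
      simp only [XX, Finset.mem_filter] at hd
      exact hd.2.2
    have e5 : (D (g * d))⁻¹ = d⁻¹ := by
      refine decomp_unique cs (hD _) hd2 ((parab cs J).inv_mem (hG (g * d)))
        ((parab cs J).inv_mem hg) ?_
      rw [← mul_inv_rev, ← hE, mul_inv_rev]
    rw [inv_inj] at e5
    simp only [e5, ← ew]
  · rintro ⟨u, v⟩ h
    simp [MonoidAlgebra.single_mul_single]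

theorem conjSet_idem {J K : Finset B} {d : W} (hd : d ∈ XX cs J K) :
    d ∈ XX cs J (conjSet cs J K d) ∧
      conjSet cs J (conjSet cs J K d) d = conjSet cs J K d := by
  constructor
  · simp only [XX, Finset.mem_filter, Finset.mem_univ, true_and] at hd ⊢
    refine ⟨?_, hd.2⟩
    rw [mem_XS]
    exact fun i hi => (mem_XS cs).mp hd.1 i (Finset.mem_filter.mp hi).1
  · simp [conjSet, Finset.filter_filter]

theorem basis_mem (R : Submodule ℚ (MonoidAlgebra ℚ W)) (C : Finset B → ℚ) (hC : ∀ J, 0 ≤ C J)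
    (hR : ∀ K, (∑ J : Finset B, C J • descentBasis cs J) * descentBasis cs K ∈ R)
    (n : ℕ) : ∀ K : Finset B, K.card = n →
      (∃ J, 0 < C J ∧ ∃ d ∈ XX cs J K, conjSet cs J K d = K) → descentBasis cs K ∈ R := by
  induction n using Nat.strong_induction_on with
  | _ n ih =>
  rintro K hn ⟨J0, hJ0, d0, hd0, e0⟩
  have h := hR K
  have e : (∑ J : Finset B, C J • descentBasis cs J) * descentBasis cs K =
      (∑ J : Finset B, C J * (((XX cs J K).filter fun d => conjSet cs J K d = K).card : ℚ)) •
        descentBasis cs K +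
      ∑ J : Finset B, C J • ∑ d ∈ (XX cs J K).filter fun d => ¬ conjSet cs J K d = K,
        descentBasis cs (conjSet cs J K d) := by
    rw [Finset.sum_mul, Finset.sum_smul, ← Finset.sum_add_distrib]
    refine Finset.sum_congr rfl fun J _ => ?_
    rw [smul_mul_assoc, mackey, mul_smul, ← smul_add,
      ← Finset.sum_filter_add_sum_filter_not (XX cs J K) (fun d => conjSet cs J K d = K)]
    congr 2
    rw [Finset.sum_congr rfl (g := fun _ => descentBasis cs K)
      (fun d hd => by rw [(Finset.mem_filter.mp hd).2]), Finset.sum_const, Nat.cast_smul_eq_nsmul]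
  rw [e] at h
  have h2 : ∑ J : Finset B, C J • ∑ d ∈ (XX cs J K).filter fun d => ¬ conjSet cs J K d = K,
        descentBasis cs (conjSet cs J K d) ∈ R := by
    refine R.sum_mem fun J _ => ?_
    rcases (hC J).eq_or_lt with h0 | h0
    · rw [← h0, zero_smul]; exact R.zero_mem
    refine R.smul_mem _ (R.sum_mem fun d hd => ?_)
    obtain ⟨hd, hne⟩ := Finset.mem_filter.mp hd
    refine ih _ ?_ _ rfl ⟨J, h0, d, conjSet_idem cs hd⟩
    rw [← hn]
    exact Finset.card_lt_card ((Finset.filter_subset _ _).ssubset_of_ne hne)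
  have h3 := (R.add_mem_iff_left h2).mp h
  refine (R.smul_mem_iff (ne_of_gt ?_)).mp h3
  refine Finset.sum_pos' (fun J _ => mul_nonneg (hC J) (Nat.cast_nonneg _))
    ⟨J0, Finset.mem_univ _, mul_pos hJ0 ?_⟩
  exact_mod_cast Finset.card_pos.mpr ⟨d0, Finset.mem_filter.mpr ⟨hd0, e0⟩⟩

end Helpers

set_option synthInstance.maxHeartbeats 1000000 in
set_option maxHeartbeats 1000000 in
/-- For nonnegative elements `a₁, …, a_r` of the descent algebra, the sum of the right
ideals `aᵢΣ(W)` equals the right ideal generated by `a₁ + ⋯ + a_r`. -/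
theorem pos_elements_sum_right_ideals {M : CoxeterMatrix B}
    (cs : CoxeterSystem M W) (A : Subalgebra ℚ (MonoidAlgebra ℚ W))
    (hA : IsDescentAlgebra cs A) (r : ℕ) (a : Fin r → MonoidAlgebra ℚ W)
    (c : Fin r → Finset B → ℚ) (hc : ∀ i I, 0 ≤ c i I)
    (ha : ∀ i, a i = ∑ I : Finset B, c i I • descentBasis cs I) :
    ∀ x : MonoidAlgebra ℚ W,
      (∃ b ∈ A, x = (∑ i, a i) * b) ↔
        ∃ b : Fin r → MonoidAlgebra ℚ W, (∀ i, b i ∈ A) ∧ x = ∑ i, a i * b i := by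
  intro x
  constructor
  · rintro ⟨b, hb, rfl⟩
    exact ⟨fun _ => b, fun _ => hb, by rw [Finset.sum_mul]⟩
  · rintro ⟨b, hb, rfl⟩
    have hmem : ∀ y, y ∈ A ↔ y ∈ Submodule.span ℚ (Set.range (descentBasis cs)) := fun y => by
      have h : (A : Set (MonoidAlgebra ℚ W)) = _ := hA
      exact Set.ext_iff.mp h y
    have hsum : ∑ i, a i = ∑ J : Finset B, (∑ i, c i J) • descentBasis cs J := by
      simp only [ha, Finset.sum_smul]
      exact Finset.sum_comm
    let R : Submodule ℚ (MonoidAlgebra ℚ W) :=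
      (Submodule.span ℚ (Set.range (descentBasis cs))).map (LinearMap.mulLeft ℚ (∑ i, a i))
    have hR : ∀ K, (∑ J : Finset B, (∑ i, c i J) • descentBasis cs J) * descentBasis cs K ∈ R := by
      intro K
      rw [← hsum]
      exact Submodule.mem_map.mpr ⟨descentBasis cs K, Submodule.subset_span ⟨K, rfl⟩, rfl⟩
    have hC : ∀ J, 0 ≤ ∑ i, c i J := fun J => Finset.sum_nonneg fun i _ => hc i J
    have hx : ∑ i, a i * b i ∈ R := by
      refine R.sum_mem fun i _ => ?_
      have hbi := (hmem _).mp (hb i)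
      generalize b i = z at hbi
      induction hbi using Submodule.span_induction with
      | mem y hy =>
        obtain ⟨L, rfl⟩ := hy
        rw [ha, Finset.sum_mul]
        refine R.sum_mem fun J _ => ?_
        rw [smul_mul_assoc]
        rcases (hc i J).eq_or_lt with h0 | h0
        · rw [← h0, zero_smul]; exact R.zero_mem
        refine R.smul_mem _ ?_
        rw [mackey]
        refine R.sum_mem fun d hd => ?_
        refine basis_mem cs R _ hC hR _ _ rfl ⟨J, ?_, d, conjSet_idem cs hd⟩
        exact Finset.sum_pos' (fun i _ => hc i J) ⟨i, Finset.mem_univ _, h0⟩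
      | zero => rw [mul_zero]; exact R.zero_mem
      | add y z _ _ hy hz => rw [mul_add]; exact R.add_mem hy hz
      | smul q y _ hy => rw [mul_smul_comm]; exact R.smul_mem _ hy
    obtain ⟨y, hy, e⟩ := Submodule.mem_map.mp hx
    exact ⟨y, (hmem y).mpr hy, e.symm⟩
end
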